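/- arXiv:0804.3774 — 4 statements merged into one kernel-verified Lean document; each statement's English description precedes it below -/
import Mathlib

section
/- Let t ↦ 𝒦(t) be a norm-continuous map from ℝ into the bounded self-adjoint operators on a complex Hilbert space, let t ↦ R(t) be a norm-continuous map from ℝ into the bounded operators, and let g : ℝ → bounded operators be differentiable in operator norm with g(0) = 0 and g'(t) = i[𝒦(t), g(t)] + R(t) for all t. Then ‖g(t)‖ ≤ ∫₀^t ‖R(s)‖ ds for all t ≥ 0. -/
/-- Conjugating by `exp (-i s K)` removes the commutator from the derivative. -/
theorem hasDerivAt_exp_conj {A : Type*} [NormedRing A] [NormedAlgebra ℂ A] [CompleteSpace A]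
    (k r : A) {g : ℝ → A} {x : ℝ} (hg : HasDerivAt g (Complex.I • ⁅k, g x⁆ + r) x) :
    HasDerivAt (fun z : ℝ ↦ NormedSpace.exp ((z - x) • (-(Complex.I • k))) * g z *
      NormedSpace.exp ((z - x) • (Complex.I • k))) r x := by
  let _ : NormedAlgebra ℝ A := NormedAlgebra.restrictScalars ℝ ℂ A
  have hexp (a : A) : HasDerivAt (fun z : ℝ ↦ NormedSpace.exp ((z - x) • a)) a x := by
    have h := hasDerivAt_exp_smul_const (𝕂 := ℝ) a (x - x)
    have h' := HasDerivAt.scomp (h := fun z : ℝ ↦ z - x) x h ((hasDerivAt_id x).sub_const x)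
    simpa [Function.comp_def] using h'
  refine (((hexp (-(Complex.I • k))).mul hg).mul (hexp (Complex.I • k))).congr_deriv ?_
  simp only [sub_self, zero_smul, NormedSpace.exp_zero, one_mul, mul_one, Pi.mul_apply,
    Ring.lie_def, smul_sub, neg_mul, smul_mul_assoc, mul_smul_comm]
  abel

/-- Conjugation by the unitary group of a self-adjoint element is isometric. -/
theorem IsSelfAdjoint.norm_exp_conj {A : Type*} [NormedRing A] [NormedAlgebra ℂ A]
    [CompleteSpace A] [StarRing A] [CStarRing A] [StarModule ℂ A]
    {k : A} (hk : IsSelfAdjoint k) (s : ℝ) (a : A) :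
    ‖NormedSpace.exp (s • (-(Complex.I • k))) * a * NormedSpace.exp (s • (Complex.I • k))‖
      = ‖a‖ := by
  let _ : NormedAlgebra ℚ A := NormedAlgebra.restrictScalars ℚ ℂ A
  have hskew (s : ℝ) : s • (Complex.I • k) ∈ skewAdjoint A := by
    rw [skewAdjoint.mem_iff, star_smul, star_smul, hk.star_eq]
    simp
  have h₁ : NormedSpace.exp (s • (-(Complex.I • k))) ∈ unitary A := by
    refine NormedSpace.exp_mem_unitary_of_mem_skewAdjoint ?_
    simpa using neg_mem (hskew s)
  have h₂ : NormedSpace.exp (s • (Complex.I • k)) ∈ unitary A :=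
    NormedSpace.exp_mem_unitary_of_mem_skewAdjoint (hskew s)
  rw [CStarRing.norm_mul_mem_unitary _ h₂, CStarRing.norm_mem_unitary_mul _ h₁]


/-- If `g` is norm-differentiable with `g(0) = 0` and
`g'(t) = i[𝒦(t), g(t)] + R(t)` for a norm-continuous family `𝒦(t)` of bounded
self-adjoint operators and a norm-continuous family `R(t)` of bounded operators, then
`‖g(t)‖ ≤ ∫₀^t ‖R(s)‖ ds` for all `t ≥ 0`. -/
theorem norm_bound_of_commutator_ode
    {E : Type*} [NormedAddCommGroup E] [InnerProductSpace ℂ E] [CompleteSpace E]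
    (K R g : ℝ → (E →L[ℂ] E))
    (hKcont : Continuous K) (hKsa : ∀ t, IsSelfAdjoint (K t)) (hRcont : Continuous R)
    (hg0 : g 0 = 0)
    (hg : ∀ t : ℝ, HasDerivAt g (Complex.I • ⁅K t, g t⁆ + R t) t)
    (t : ℝ) (ht : 0 ≤ t) :
    ‖g t‖ ≤ ∫ s in (0:ℝ)..t, ‖R s‖ := by
  have hR : Continuous fun s ↦ ‖R s‖ := hRcont.norm
  have hgcont : Continuous g := continuous_iff_continuousAt.2 fun s ↦ (hg s).continuousAt
  have hB (s : ℝ) : HasDerivAt (fun u ↦ ∫ v in (0 : ℝ)..u, ‖R v‖) ‖R s‖ s :=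
    hR.integral_hasStrictDerivAt 0 s |>.hasDerivAt
  refine image_le_of_liminf_slope_right_le_deriv_boundary (f := fun s ↦ ‖g s‖) (a := 0) (b := t)
    (B := fun u ↦ ∫ v in (0 : ℝ)..u, ‖R v‖) (B' := fun s ↦ ‖R s‖)
    hgcont.norm.continuousOn (by simp [hg0])
    (fun s _ ↦ (hB s).continuousAt.continuousWithinAt) (fun s _ ↦ (hB s).hasDerivWithinAt)
    (fun x _ r hr ↦ ?_) (Set.right_mem_Icc.2 ht)
  have h := (hasDerivAt_exp_conj (K x) (R x) (hg x)).hasDerivWithinAt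
    (s := Set.Ici x) |>.liminf_right_slope_norm_le hr
  simpa only [(hKsa x).norm_exp_conj, slope_def_field, div_eq_inv_mul] using h
end

section
/- Let m, n, N be positive integers and v > 0. Let f, g : [0,∞) → ℝ be measurable with f ≥ 0 and 0 ≤ g(t) ≤ 2 for all t ≥ 0, and suppose that g(t) ≤ (8 m v / N) t + 4 v ∫₀^t g(s) ds and f(t) ≤ (4 m n v / N) t + 2 n v ∫₀^t g(s) ds for all t ≥ 0. Then f(t) ≤ (m n / N)(e^{4 v t} − 1) for all t ≥ 0. -/
/-- Gronwall's inequality in integral form, with inhomogeneity linear in time, for a locally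
integrable function that need not be continuous. -/
theorem linear_add_integral_le_of_le_linear_add_integral {h : ℝ → ℝ} {A K : ℝ} (hK : 0 < K)
    (hint : ∀ a b : ℝ, IntervalIntegrable h MeasureTheory.volume a b)
    (hle : ∀ t : ℝ, 0 ≤ t → h t ≤ A * t + K * ∫ s in (0:ℝ)..t, h s) {t : ℝ} (ht : 0 ≤ t) :
    A * t + K * ∫ s in (0:ℝ)..t, h s ≤ A / K * (Real.exp (K * t) - 1) := by
  set u : ℝ → ℝ := fun t => A * t + K * ∫ s in (0:ℝ)..t, h s with hu
  have hucont : Continuous u :=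
    (continuous_const.mul continuous_id).add
      (continuous_const.mul (intervalIntegral.continuous_primitive hint 0))
  set V : ℝ → ℝ := fun t => ∫ s in (0:ℝ)..t, u s with hV
  have hVderiv (x : ℝ) : HasDerivAt V (u x) x := hucont.integral_hasStrictDerivAt 0 x |>.hasDerivAt
  have huV {x : ℝ} (hx : 0 ≤ x) : u x ≤ A * x + K * V x := by
    have hmono : ∫ s in (0:ℝ)..x, h s ≤ V x :=
      intervalIntegral.integral_mono_on hx (hint 0 x) (hucont.intervalIntegrable 0 x)
        fun s hs => hle s hs.1
    have := mul_le_mul_of_nonneg_left hmono hK.le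
    simp only [hu]
    linarith
  set W : ℝ → ℝ := fun x => Real.exp (-K * x) * (V x + A / K * x + A / K ^ 2) with hW
  have hWderiv (x : ℝ) :
      HasDerivAt W (Real.exp (-K * x) * (u x - (A * x + K * V x))) x := by
    have hexp : HasDerivAt (fun x : ℝ => Real.exp (-K * x)) (Real.exp (-K * x) * (-K * 1)) x :=
      ((hasDerivAt_id x).const_mul (-K)).exp
    have hlin : HasDerivAt (fun x : ℝ => A / K * x) (A / K * 1) x :=
      (hasDerivAt_id x).const_mul (A / K)
    refine (hexp.mul (((hVderiv x).add hlin).add_const (A / K ^ 2))).congr_deriv ?_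
    simp only [Pi.add_apply]
    field_simp
    ring
  have hWanti : AntitoneOn W (Set.Ici 0) := by
    refine antitoneOn_of_deriv_nonpos (convex_Ici 0)
      (fun x _ => (hWderiv x).continuousAt.continuousWithinAt)
      (fun x _ => (hWderiv x).differentiableAt.differentiableWithinAt) fun x hx => ?_
    rw [(hWderiv x).deriv]
    exact mul_nonpos_of_nonneg_of_nonpos (Real.exp_pos _).le
      (sub_nonpos.mpr (huV (interior_subset hx)))
  have hWt : Real.exp (-K * t) * (V t + A / K * t + A / K ^ 2) ≤ A / K ^ 2 := by
    simpa [hW, hV] using hWanti Set.self_mem_Ici (Set.mem_Ici.mpr ht) ht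
  have hVt : V t + A / K * t + A / K ^ 2 ≤ A / K ^ 2 * Real.exp (K * t) := by
    rw [neg_mul, Real.exp_neg] at hWt
    exact (inv_mul_le_iff₀' (Real.exp_pos _)).mp hWt
  calc u t ≤ A * t + K * V t := huV ht
    _ = K * (V t + A / K * t + A / K ^ 2) - A / K := by field_simp; ring
    _ ≤ K * (A / K ^ 2 * Real.exp (K * t)) - A / K := by gcongr
    _ = A / K * (Real.exp (K * t) - 1) := by field_simp

/-- The coupled pair of integral inequalities at the core of Theorem 2.1:
if `g(t) ≤ (8mv/N) t + 4v ∫₀^t g` with `0 ≤ g ≤ 2`, and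
`f(t) ≤ (4mnv/N) t + 2nv ∫₀^t g` with `f ≥ 0`, then
`f(t) ≤ (mn/N)(e^{4vt} − 1)` for all `t ≥ 0`. -/
theorem coupled_commutator_gronwall
    (m n N : ℕ) (hm : 0 < m) (hn : 0 < n) (hN : 0 < N) (v : ℝ) (hv : 0 < v)
    (f g : ℝ → ℝ) (hfmeas : Measurable f) (hgmeas : Measurable g)
    (hf0 : ∀ t : ℝ, 0 ≤ t → 0 ≤ f t)
    (hgbd : ∀ t : ℝ, 0 ≤ t → 0 ≤ g t ∧ g t ≤ 2)
    (hg : ∀ t : ℝ, 0 ≤ t →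
      g t ≤ (8 * m * v / N) * t + 4 * v * ∫ s in (0:ℝ)..t, g s)
    (hf : ∀ t : ℝ, 0 ≤ t →
      f t ≤ (4 * m * n * v / N) * t + 2 * n * v * ∫ s in (0:ℝ)..t, g s) :
    ∀ t : ℝ, 0 ≤ t → f t ≤ (m * n / N) * (Real.exp (4 * v * t) - 1) := by
  intro t ht
  set h : ℝ → ℝ := fun s => g (max s 0) with hh
  have hmeas : Measurable h := hgmeas.comp (measurable_id.max measurable_const)
  have hint (a b : ℝ) : IntervalIntegrable h MeasureTheory.volume a b := by
    refine (intervalIntegrable_const (c := (2 : ℝ))).mono_fun hmeas.aestronglyMeasurable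
      (Filter.Eventually.of_forall fun s => ?_)
    obtain ⟨h0, h2⟩ := hgbd (max s 0) (le_max_right s 0)
    simpa [hh, abs_of_nonneg h0] using h2
  have hgh {x : ℝ} (hx : 0 ≤ x) : ∫ s in (0:ℝ)..x, h s = ∫ s in (0:ℝ)..x, g s := by
    refine intervalIntegral.integral_congr fun s hs => ?_
    rw [Set.uIcc_of_le hx] at hs
    simp [hh, hs.1]
  have hle (x : ℝ) (hx : 0 ≤ x) :
      h x ≤ (8 * m * v / N) * x + 4 * v * ∫ s in (0:ℝ)..x, h s := by
    rw [hgh hx]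
    simpa [hh, hx] using hg x hx
  have hbound := linear_add_integral_le_of_le_linear_add_integral
    (mul_pos four_pos hv) hint hle ht
  rw [hgh ht] at hbound
  have hN' : (N : ℝ) ≠ 0 := Nat.cast_ne_zero.mpr hN.ne'
  calc f t ≤ (4 * m * n * v / N) * t + 2 * n * v * ∫ s in (0:ℝ)..t, g s := hf t ht
    _ = n / 2 * ((8 * m * v / N) * t + 4 * v * ∫ s in (0:ℝ)..t, g s) := by ring
    _ ≤ n / 2 * (8 * m * v / N / (4 * v) * (Real.exp (4 * v * t) - 1)) := by gcongr
    _ = (m * n / N) * (Real.exp (4 * v * t) - 1) := by field_simp; ring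
end

section
/- Let C > 0, D ≥ 0, M ≥ 0, and let f : [0,∞) → ℝ be measurable with 0 ≤ f(t) ≤ M for all t ≥ 0, satisfying f(t) ≤ C ∫₀^t f(s) ds + D (e^{2Ct} − 1) for all t ≥ 0. Then f(t) ≤ 2D (e^{2Ct} − 1) for all t ≥ 0. -/
/-- Iterating the integral inequality `n` times leaves a remainder `M (Ct)ⁿ / n!`. -/
theorem gronwall_exp_inhomogeneous_iterate
    {C D M : ℝ} (hC : 0 < C) (hD : 0 ≤ D)
    {f : ℝ → ℝ} (hmeas : Measurable f)
    (hbd : ∀ t : ℝ, 0 ≤ t → 0 ≤ f t ∧ f t ≤ M)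
    (hineq : ∀ t : ℝ, 0 ≤ t →
      f t ≤ C * (∫ s in (0:ℝ)..t, f s) + D * (Real.exp (2 * C * t) - 1)) (n : ℕ) :
    ∀ t : ℝ, 0 ≤ t →
      f t ≤ 2 * D * (Real.exp (2 * C * t) - 1) + M * ((C * t) ^ n / n.factorial) := by
  induction n with
  | zero =>
    intro t ht
    have hexp : 1 ≤ Real.exp (2 * C * t) := Real.one_le_exp (by positivity)
    have hnonneg : 0 ≤ 2 * D * (Real.exp (2 * C * t) - 1) :=
      mul_nonneg (by positivity) (by linarith)
    have := (hbd t ht).2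
    simp only [pow_zero, Nat.factorial_zero, Nat.cast_one, div_one, mul_one]
    linarith
  | succ n ih =>
    intro t ht
    have hf : IntervalIntegrable f MeasureTheory.volume 0 t := by
      refine (intervalIntegrable_const (c := M)).mono_fun hmeas.aestronglyMeasurable ?_
      refine (MeasureTheory.ae_restrict_mem measurableSet_uIoc).mono fun s hs => ?_
      rw [Set.uIoc_of_le ht] at hs
      have := hbd s hs.1.le
      refine (Real.norm_of_nonneg this.1).trans_le ?_
      exact this.2.trans (le_abs_self M)
    have hcont : Continuous fun s : ℝ =>
        2 * D * (Real.exp (2 * C * s) - 1) + M * ((C * s) ^ n / n.factorial) := by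
      fun_prop
    have hmono := intervalIntegral.integral_mono_on ht hf (hcont.intervalIntegrable 0 t)
      fun s hs => ih s hs.1
    have hderiv : ∀ s ∈ Set.uIcc 0 t, HasDerivAt
        (fun s : ℝ => D / C * Real.exp (2 * C * s) - 2 * D * s
          + M / C * ((C * s) ^ (n + 1) / (n + 1).factorial))
        (2 * D * (Real.exp (2 * C * s) - 1) + M * ((C * s) ^ n / n.factorial)) s := by
      intro s _
      have hlin (c : ℝ) : HasDerivAt (fun s : ℝ => c * s) c s := by
        simpa using (hasDerivAt_id s).const_mul c
      have hfact : (n.factorial : ℝ) ≠ 0 := by positivity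
      refine ((((hlin (2 * C)).exp.const_mul (D / C)).sub (hlin (2 * D))).add
        ((((hlin C).pow (n + 1)).div_const ((n + 1).factorial : ℝ)).const_mul
          (M / C))).congr_deriv ?_
      rw [Nat.factorial_succ]
      push_cast
      field_simp
    rw [intervalIntegral.integral_eq_sub_of_hasDerivAt hderiv (hcont.intervalIntegrable 0 t)]
      at hmono
    have hscaled := mul_le_mul_of_nonneg_left hmono hC.le
    have hvalue : C * ((D / C * Real.exp (2 * C * t) - 2 * D * t
          + M / C * ((C * t) ^ (n + 1) / (n + 1).factorial))
        - (D / C * Real.exp (2 * C * 0) - 2 * D * 0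
          + M / C * ((C * 0) ^ (n + 1) / (n + 1).factorial)))
        = D * (Real.exp (2 * C * t) - 1) - 2 * C * D * t
          + M * ((C * t) ^ (n + 1) / (n + 1).factorial) := by
      simp only [mul_zero, Real.exp_zero, ne_eq, Nat.add_eq_zero_iff, one_ne_zero, and_false,
        not_false_eq_true, zero_pow, zero_div]
      field_simp
      ring
    have hdrop : 0 ≤ 2 * C * D * t := by positivity
    linarith [hineq t ht]

/-- **Grönwall-type lemma (one-particle marginal).** If `f` is measurable with
`0 ≤ f ≤ M` on `[0,∞)` and `f(t) ≤ C ∫₀^t f(s) ds + D (e^{2Ct} − 1)` for all `t ≥ 0`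
(with `C > 0`, `D ≥ 0`, `M ≥ 0`), then `f(t) ≤ 2D (e^{2Ct} − 1)` for all `t ≥ 0`. -/
theorem gronwall_exp_inhomogeneous_double
    (C D M : ℝ) (hC : 0 < C) (hD : 0 ≤ D) (hM : 0 ≤ M)
    (f : ℝ → ℝ) (hmeas : Measurable f)
    (hbd : ∀ t : ℝ, 0 ≤ t → 0 ≤ f t ∧ f t ≤ M)
    (hineq : ∀ t : ℝ, 0 ≤ t →
      f t ≤ C * (∫ s in (0:ℝ)..t, f s) + D * (Real.exp (2 * C * t) - 1)) :
    ∀ t : ℝ, 0 ≤ t → f t ≤ 2 * D * (Real.exp (2 * C * t) - 1) := by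
  intro t ht
  have hlim : Filter.Tendsto
      (fun n : ℕ => 2 * D * (Real.exp (2 * C * t) - 1) + M * ((C * t) ^ n / n.factorial))
      Filter.atTop (nhds (2 * D * (Real.exp (2 * C * t) - 1))) := by
    simpa using ((FloorSemiring.tendsto_pow_div_factorial_atTop (C * t)).const_mul M).const_add
      (2 * D * (Real.exp (2 * C * t) - 1))
  exact ge_of_tendsto' hlim fun n =>
    gronwall_exp_inhomogeneous_iterate hC hD hmeas hbd hineq n t ht
end

section
/- Let v > 0, λ ≥ 0, N ≥ 1 and k ≥ 1 (k, N integers). Let f₁, f_k : [0,∞) → ℝ be measurable with 0 ≤ f₁(t) ≤ 2 and 0 ≤ f_k(t) ≤ 2 for all t ≥ 0, satisfying for all t ≥ 0: f₁(t) ≤ 4v ∫₀^t f₁(s) ds + (λ/(2N)) (e^{8vt} − 1), and f_k(t) ≤ 2kv ∫₀^t ( f_k(s) + f₁(s) ) ds + (k² λ/(2N)) (e^{8vt} − 1). Then f₁(t) ≤ (λ/N)(e^{8vt} − 1) and f_k(t) ≤ (k² λ/N) e^{2kvt} (e^{8vt} − 1) for all t ≥ 0. -/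
open MeasureTheory intervalIntegral Filter

/-- Homogeneous Grönwall inequality in integral form, without continuity of `w`. -/
theorem nonpos_of_le_mul_integral {w : ℝ → ℝ} {a M : ℝ} (ha : 0 ≤ a)
    (hwi : ∀ t, 0 ≤ t → IntervalIntegrable w volume 0 t)
    (hM : ∀ t, 0 ≤ t → w t ≤ M)
    (h : ∀ t, 0 ≤ t → w t ≤ a * ∫ s in (0:ℝ)..t, w s) :
    ∀ t, 0 ≤ t → w t ≤ 0 := by
  have key : ∀ n : ℕ, ∀ t, 0 ≤ t → w t ≤ M * ((a * t) ^ n / n.factorial) := by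
    intro n
    induction n with
    | zero => intro t ht; simpa using hM t ht
    | succ n ih =>
      intro t ht
      have hmono : ∫ s in (0:ℝ)..t, w s ≤
          ∫ s in (0:ℝ)..t, M * ((a * s) ^ n / n.factorial) :=
        integral_mono_on ht (hwi t ht)
          ((by fun_prop : Continuous fun s : ℝ =>
            M * ((a * s) ^ n / n.factorial)).intervalIntegrable _ _)
          (fun s hs => ih s hs.1)
      have hval : ∫ s in (0:ℝ)..t, M * ((a * s) ^ n / n.factorial) =
          M * (a ^ n * (t ^ (n + 1) / (n + 1)) / n.factorial) := by
        simp [mul_pow]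
      refine (h t ht).trans ((mul_le_mul_of_nonneg_left hmono ha).trans (le_of_eq ?_))
      rw [hval, Nat.factorial_succ]
      push_cast
      field_simp
      ring
  intro t ht
  have hlim := (FloorSemiring.tendsto_pow_div_factorial_atTop (a * t)).const_mul M
  rw [mul_zero] at hlim
  exact ge_of_tendsto' hlim fun n => key n t ht

/-- A measurable function with values in `[0, C]` on `[0, ∞)` is integrable on `[0, t]`. -/
theorem intervalIntegrable_of_measurable_of_bounded {f : ℝ → ℝ} {C : ℝ} (hf : Measurable f)
    (hbd : ∀ t : ℝ, 0 ≤ t → 0 ≤ f t ∧ f t ≤ C) (t : ℝ) (ht : 0 ≤ t) :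
    IntervalIntegrable f volume 0 t := by
  refine (intervalIntegrable_const (c := C) (μ := volume)).mono_fun hf.aestronglyMeasurable ?_
  refine (ae_restrict_iff' measurableSet_uIoc).2 (Eventually.of_forall fun s hs => ?_)
  rw [Set.uIoc_of_le ht] at hs
  obtain ⟨h0, h1⟩ := hbd s hs.1.le
  exact (Real.norm_of_nonneg h0).trans_le (h1.trans (Real.le_norm_self C))

/-- Grönwall comparison: an integral subsolution lies below any nonnegative continuous
integral supersolution. -/
theorem le_of_integral_subsolution {f u b : ℝ → ℝ} {a C : ℝ} (ha : 0 ≤ a)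
    (hf : Measurable f) (hbd : ∀ t : ℝ, 0 ≤ t → 0 ≤ f t ∧ f t ≤ C)
    (hu : Continuous u) (hu0 : ∀ t, 0 ≤ t → 0 ≤ u t)
    (hsub : ∀ t, 0 ≤ t → f t ≤ a * (∫ s in (0:ℝ)..t, f s) + b t)
    (hsuper : ∀ t, 0 ≤ t → a * (∫ s in (0:ℝ)..t, u s) + b t ≤ u t) :
    ∀ t, 0 ≤ t → f t ≤ u t := by
  have hfi := intervalIntegrable_of_measurable_of_bounded hf hbd
  have hui : ∀ t, IntervalIntegrable u volume 0 t := fun t => hu.intervalIntegrable _ _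
  intro t ht
  refine sub_nonpos.1 (nonpos_of_le_mul_integral (w := fun t => f t - u t) (M := C) ha
    (fun t ht => (hfi t ht).sub (hui t))
    (fun t ht => by linarith [(hbd t ht).2, hu0 t ht]) (fun t ht => ?_) t ht)
  rw [integral_sub (hfi t ht) (hui t), mul_sub]
  linarith [hsub t ht, hsuper t ht]

theorem integral_exp_mul_sub_one {c : ℝ} (hc : c ≠ 0) (t : ℝ) :
    ∫ s in (0:ℝ)..t, (Real.exp (c * s) - 1) = (Real.exp (c * t) - 1) / c - t := by
  have hd : ∀ s ∈ Set.uIcc 0 t,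
      HasDerivAt (fun s => Real.exp (c * s) / c - s) (Real.exp (c * s) - 1) s := by
    intro s _
    have := ((((hasDerivAt_id' s).const_mul c).exp).div_const c).sub (hasDerivAt_id' s)
    refine this.congr_deriv ?_
    field_simp
  rw [integral_eq_sub_of_hasDerivAt hd ((by fun_prop :
    Continuous fun s : ℝ => Real.exp (c * s) - 1).intervalIntegrable _ _)]
  simp
  ring

/-- The function `e^{as} (e^{cs} - 1)` is an integral supersolution for the rate `a` and the
source `e^{ct} - 1`. -/
theorem mul_integral_exp_mul_add_le {a c : ℝ} (ha : 0 ≤ a) (hc : 0 ≤ c) (t : ℝ) (ht : 0 ≤ t) :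
    a * (∫ s in (0:ℝ)..t, Real.exp (a * s) * (Real.exp (c * s) - 1)) + (Real.exp (c * t) - 1) ≤
      Real.exp (a * t) * (Real.exp (c * t) - 1) := by
  have hd : ∀ s ∈ Set.uIcc 0 t,
      HasDerivAt (fun s => Real.exp (a * s) * (Real.exp (c * s) - 1) - (Real.exp (c * s) - 1))
        (a * (Real.exp (a * s) * (Real.exp (c * s) - 1)) +
          c * Real.exp (c * s) * (Real.exp (a * s) - 1)) s := by
    intro s _
    have h1 := ((hasDerivAt_id' s).const_mul a).exp
    have h2 := (((hasDerivAt_id' s).const_mul c).exp).sub_const 1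
    refine ((h1.mul h2).sub h2).congr_deriv ?_
    ring
  have hI := integral_eq_sub_of_hasDerivAt hd ((by fun_prop : Continuous _).intervalIntegrable _ _)
  have hle : ∫ s in (0:ℝ)..t, a * (Real.exp (a * s) * (Real.exp (c * s) - 1)) ≤
      ∫ s in (0:ℝ)..t, (a * (Real.exp (a * s) * (Real.exp (c * s) - 1)) +
          c * Real.exp (c * s) * (Real.exp (a * s) - 1)) := by
    refine integral_mono_on ht ((by fun_prop : Continuous _).intervalIntegrable _ _)
      ((by fun_prop : Continuous _).intervalIntegrable _ _) fun s hs => ?_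
    have h1 : 0 ≤ Real.exp (a * s) - 1 :=
      sub_nonneg.2 (Real.one_le_exp (mul_nonneg ha hs.1))
    have : 0 ≤ c * Real.exp (c * s) * (Real.exp (a * s) - 1) := by positivity
    linarith
  rw [intervalIntegral.integral_const_mul, hI] at hle
  simp only [mul_zero, Real.exp_zero, sub_self] at hle
  linarith

/-- **Coupled Grönwall system for the marginals (Section 3 of the paper).**
If `0 ≤ f₁ ≤ 2`, `0 ≤ f_k ≤ 2` are measurable on `[0,∞)` with
`f₁(t) ≤ 4v ∫₀^t f₁ + (λ/(2N))(e^{8vt} − 1)` and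
`f_k(t) ≤ 2kv ∫₀^t (f_k + f₁) + (k²λ/(2N))(e^{8vt} − 1)`,
then `f₁(t) ≤ (λ/N)(e^{8vt} − 1)` and `f_k(t) ≤ (k²λ/N) e^{2kvt} (e^{8vt} − 1)`. -/
theorem coupled_marginal_gronwall
    (v : ℝ) (hv : 0 < v) (lam : ℝ) (hlam : 0 ≤ lam)
    (N k : ℕ) (hN : 1 ≤ N) (hk : 1 ≤ k)
    (f1 fk : ℝ → ℝ) (hf1meas : Measurable f1) (hfkmeas : Measurable fk)
    (hf1bd : ∀ t : ℝ, 0 ≤ t → 0 ≤ f1 t ∧ f1 t ≤ 2)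
    (hfkbd : ∀ t : ℝ, 0 ≤ t → 0 ≤ fk t ∧ fk t ≤ 2)
    (h1 : ∀ t : ℝ, 0 ≤ t →
      f1 t ≤ 4 * v * (∫ s in (0:ℝ)..t, f1 s) +
        lam / (2 * N) * (Real.exp (8 * v * t) - 1))
    (h2 : ∀ t : ℝ, 0 ≤ t →
      fk t ≤ 2 * k * v * (∫ s in (0:ℝ)..t, fk s + f1 s) +
        k ^ 2 * lam / (2 * N) * (Real.exp (8 * v * t) - 1)) :
    ∀ t : ℝ, 0 ≤ t →
      f1 t ≤ lam / N * (Real.exp (8 * v * t) - 1) ∧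
      fk t ≤ k ^ 2 * lam / N * Real.exp (2 * k * v * t) * (Real.exp (8 * v * t) - 1) := by
  have hE : ∀ t : ℝ, 0 ≤ t → 0 ≤ Real.exp (8 * v * t) - 1 := fun t ht =>
    sub_nonneg.2 (Real.one_le_exp (by positivity))
  have hNpos : (0:ℝ) < N := by exact_mod_cast hN
  have hk1 : (1:ℝ) ≤ k := by exact_mod_cast hk
  obtain ⟨c, hc⟩ : ∃ c : ℝ, c = lam / (2 * N) := ⟨_, rfl⟩
  have hc0 : 0 ≤ c := by rw [hc]; positivity
  have e1 : lam / N = 2 * c := by rw [hc]; field_simp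
  have e2 : (k:ℝ) ^ 2 * lam / N = 2 * (k ^ 2 * c) := by rw [hc]; field_simp
  have e3 : (k:ℝ) ^ 2 * lam / (2 * N) = k ^ 2 * c := by rw [hc]; field_simp
  simp only [e3] at h2
  simp only [← hc] at h1
  rw [e1, e2]
  have hf1 : ∀ t : ℝ, 0 ≤ t → f1 t ≤ 2 * c * (Real.exp (8 * v * t) - 1) := by
    refine le_of_integral_subsolution (by positivity) hf1meas hf1bd (by fun_prop)
      (fun t ht => mul_nonneg (by positivity) (hE t ht)) h1 fun t ht => ?_
    rw [intervalIntegral.integral_const_mul, integral_exp_mul_sub_one (by positivity)]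
    have h3 : 4 * v * (2 * c * ((Real.exp (8 * v * t) - 1) / (8 * v) - t)) =
        c * (Real.exp (8 * v * t) - 1) - 8 * v * c * t := by
      field_simp
      ring
    have : 0 ≤ 8 * v * c * t := by positivity
    linarith
  have hf1i := intervalIntegrable_of_measurable_of_bounded hf1meas hf1bd
  have hfki := intervalIntegrable_of_measurable_of_bounded hfkmeas hfkbd
  have hsource : ∀ t : ℝ, 0 ≤ t →
      2 * k * v * (∫ s in (0:ℝ)..t, f1 s) ≤ k ^ 2 * c * (Real.exp (8 * v * t) - 1) := by
    intro t ht
    have hle : ∫ s in (0:ℝ)..t, f1 s ≤ ∫ s in (0:ℝ)..t, 2 * c * (Real.exp (8 * v * s) - 1) :=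
      integral_mono_on ht (hf1i t ht) ((by fun_prop : Continuous _).intervalIntegrable _ _)
        fun s hs => hf1 s hs.1
    rw [intervalIntegral.integral_const_mul, integral_exp_mul_sub_one (by positivity)] at hle
    have h3 : 2 * k * v * (2 * c * ((Real.exp (8 * v * t) - 1) / (8 * v) - t)) =
        k / 2 * (c * (Real.exp (8 * v * t) - 1)) - 4 * k * v * c * t := by
      field_simp
      ring
    have h4 : 0 ≤ 4 * k * v * c * t := by positivity
    have h5 : (k:ℝ) / 2 * (c * (Real.exp (8 * v * t) - 1)) ≤
        k ^ 2 * (c * (Real.exp (8 * v * t) - 1)) :=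
      mul_le_mul_of_nonneg_right (by nlinarith) (mul_nonneg hc0 (hE t ht))
    have h6 := mul_le_mul_of_nonneg_left hle (by positivity : (0:ℝ) ≤ 2 * k * v)
    linarith
  have hfk : ∀ t : ℝ, 0 ≤ t → fk t ≤
      2 * (k ^ 2 * c) * (Real.exp (2 * k * v * t) * (Real.exp (8 * v * t) - 1)) := by
    refine le_of_integral_subsolution (a := 2 * k * v)
      (b := fun t => 2 * (k ^ 2 * c) * (Real.exp (8 * v * t) - 1)) (by positivity)
      hfkmeas hfkbd (by fun_prop)
      (fun t ht => mul_nonneg (by positivity) (mul_nonneg (Real.exp_nonneg _) (hE t ht)))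
      (fun t ht => ?_) fun t ht => ?_
    · have := h2 t ht
      rw [integral_add (hfki t ht) (hf1i t ht), mul_add] at this
      linarith [hsource t ht]
    · rw [intervalIntegral.integral_const_mul]
      have := mul_le_mul_of_nonneg_left
        (mul_integral_exp_mul_add_le (by positivity : (0:ℝ) ≤ 2 * k * v)
          (by positivity : (0:ℝ) ≤ 8 * v) t ht) (by positivity : 0 ≤ 2 * (k ^ 2 * c))
      linarith
  intro t ht
  refine ⟨hf1 t ht, ?_⟩
  rw [mul_assoc]
  exact hfk t ht
end
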